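/- Let A ∈ ℝ^{d×d} and let B ∈ ℝ^{d×p} have full row rank (so that B Bᵀ is invertible), let W ≻ 0 be a symmetric d×d matrix and α ∈ [0,1). Define G = −Bᵀ(B Bᵀ)^{−1} A ∈ ℝ^{p×d} and Σ₀ = [I; G] W [I; G]ᵀ, i.e., the (d+p)×(d+p) matrix with blocks Σ₀ = [[W, W Gᵀ],[G W, G W Gᵀ]]. Then Σ₀ belongs to the COCO-LQ feasible set F(A, B, W, α); in particular, F(A, B, W, α) is nonempty. -/

import Mathlib

open Matrix

/-- Spectral norm (operator 2-norm) of a real matrix. -/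
noncomputable def specNorm {m n : Type*} [Fintype m] [Fintype n] [DecidableEq n]
    (M : Matrix m n ℝ) : ℝ :=
  ‖LinearMap.toContinuousLinearMap (Matrix.toEuclideanLin M)‖

/-- Apply a matrix to a Euclidean-space vector. -/
noncomputable def applyMat {m n : Type*} [Fintype m] [Fintype n] [DecidableEq n]
    (M : Matrix m n ℝ) (x : EuclideanSpace ℝ n) : EuclideanSpace ℝ m :=
  Matrix.toEuclideanLin M x

/-- The horizontal concatenation `[A B]`. -/
def ABmat {d q : Type*} (A : Matrix d d ℝ) (B : Matrix d q ℝ) : Matrix d (d ⊕ q) ℝ :=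
  Matrix.of fun i => Sum.elim (A i) (B i)

/-- The COCO-LQ feasible set `F(A, B, W, α)`: `Σ ⪰ 0`,
`Σ_xx = [A B] Σ [A B]ᵀ + W`, and `[A B] Σ [A B]ᵀ ⪯ α Σ_xx`. -/
def Feasible {d q : Type*} [Fintype d] [Fintype q] [DecidableEq d] [DecidableEq q]
    (A : Matrix d d ℝ) (B : Matrix d q ℝ) (W : Matrix d d ℝ) (α : ℝ)
    (S : Matrix (d ⊕ q) (d ⊕ q) ℝ) : Prop :=
  S.PosSemidef ∧
  S.toBlocks₁₁ = ABmat A B * S * (ABmat A B)ᵀ + W ∧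
  (α • S.toBlocks₁₁ - ABmat A B * S * (ABmat A B)ᵀ).PosSemidef

/-- The COCO-LQ cost `c(Σ) = Tr(Q Σ_xx) + Tr(R Σ_uu)`. -/
def cost {d q : Type*} [Fintype d] [Fintype q]
    (Q : Matrix d d ℝ) (R : Matrix q q ℝ) (S : Matrix (d ⊕ q) (d ⊕ q) ℝ) : ℝ :=
  (Q * S.toBlocks₁₁).trace + (R * S.toBlocks₂₂).trace

lemma ABmat_eq_fromCols {d q : Type*} (A : Matrix d d ℝ) (B : Matrix d q ℝ) :
    ABmat A B = Matrix.fromCols A B := by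
  ext i (j | j) <;> rfl

lemma fromBlocks_eq_fromRows_mul_mul_transpose {m n : Type*} [Fintype m] [DecidableEq m]
    (W : Matrix m m ℝ) (G : Matrix n m ℝ) :
    Matrix.fromBlocks W (W * Gᵀ) (G * W) (G * W * Gᵀ) =
      Matrix.fromRows 1 G * W * (Matrix.fromRows 1 G)ᵀ := by
  simp [Matrix.transpose_fromRows, Matrix.fromRows_mul]

lemma isUnit_mul_transpose_self_of_rank_eq {m n : Type*} [Fintype m] [Fintype n]
    [DecidableEq m] (B : Matrix m n ℝ) (hB : B.rank = Fintype.card m) :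
    IsUnit (B * Bᵀ) := by
  rw [← Matrix.rank_self_mul_transpose] at hB
  rw [← Matrix.mulVec_surjective_iff_isUnit, ← Matrix.coe_mulVecLin, ← LinearMap.range_eq_top]
  apply Submodule.eq_top_of_finrank_eq
  rw [Module.finrank_fintype_fun_eq_card]
  exact hB

lemma add_mul_neg_transpose_mul_inv_mul {m n k : Type*} [Fintype m] [Fintype n]
    [DecidableEq m] (A : Matrix m k ℝ) (B : Matrix m n ℝ) (hB : B.rank = Fintype.card m) :
    A + B * -(Bᵀ * (B * Bᵀ)⁻¹ * A) = 0 := by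
  have h := (Matrix.isUnit_iff_isUnit_det _).mp (isUnit_mul_transpose_self_of_rank_eq B hB)
  rw [Matrix.mul_neg, ← Matrix.mul_assoc, ← Matrix.mul_assoc, Matrix.mul_nonsing_inv _ h,
    Matrix.one_mul, add_neg_cancel]

lemma feasible_of_add_mul_eq_zero {d q : Type*} [Fintype d] [Fintype q] [DecidableEq d]
    [DecidableEq q] (A : Matrix d d ℝ) (B : Matrix d q ℝ) (W : Matrix d d ℝ)
    (hW : W.PosSemidef) (α : ℝ) (hα : 0 ≤ α) (G : Matrix q d ℝ) (hG : A + B * G = 0) :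
    Feasible A B W α (Matrix.fromBlocks W (W * Gᵀ) (G * W) (G * W * Gᵀ)) := by
  have hz : ABmat A B * Matrix.fromBlocks W (W * Gᵀ) (G * W) (G * W * Gᵀ) *
      (ABmat A B)ᵀ = 0 := by
    have h : ABmat A B * Matrix.fromRows (1 : Matrix d d ℝ) G = 0 := by
      rw [ABmat_eq_fromCols, Matrix.fromCols_mul_fromRows, Matrix.mul_one, hG]
    rw [fromBlocks_eq_fromRows_mul_mul_transpose, ← Matrix.mul_assoc, ← Matrix.mul_assoc, h]
    simp
  refine ⟨?_, ?_, ?_⟩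
  · rw [fromBlocks_eq_fromRows_mul_mul_transpose, ← Matrix.conjTranspose_eq_transpose_of_trivial]
    exact hW.mul_mul_conjTranspose_same _
  · rw [hz, Matrix.toBlocks_fromBlocks₁₁, zero_add]
  · rw [hz, Matrix.toBlocks_fromBlocks₁₁, sub_zero]
    exact hW.smul hα

/-- Lemma 2 of the paper: if `B` has full row rank, then with
`G = −Bᵀ(BBᵀ)⁻¹A` the matrix `Σ₀ = [[W, WGᵀ],[GW, GWGᵀ]]` belongs to `F(A, B, W, α)`;
in particular the COCO-LQ feasible set is nonempty. -/
theorem stmt6 {d p : ℕ}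
    (A : Matrix (Fin d) (Fin d) ℝ) (B : Matrix (Fin d) (Fin p) ℝ)
    (hB : B.rank = d)
    (W : Matrix (Fin d) (Fin d) ℝ) (hW : W.PosDef)
    (α : ℝ) (hα0 : 0 ≤ α) (hα1 : α < 1)
    (G : Matrix (Fin p) (Fin d) ℝ) (hG : G = -(Bᵀ * (B * Bᵀ)⁻¹ * A)) :
    Feasible A B W α
      (Matrix.fromBlocks W (W * Gᵀ) (G * W) (G * W * Gᵀ)) ∧
    ∃ S, Feasible A B W α S := by
  have h := feasible_of_add_mul_eq_zero A B W hW.posSemidef α hα0 G (by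
    rw [hG]
    exact add_mul_neg_transpose_mul_inv_mul A B (by simpa using hB))
  exact ⟨h, _, h⟩
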